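/- There exists a constant C depending only on d and n, and independent of t₀, such that for every t₀ ∈ ℝ the ℓ³ norm of the kernel-weighted oscillatory sum decays: ‖𝔉^{Ker}(·,t₀)‖_{ℓ³} = ( ∑_{m∈ℤ^d} |𝔉^{Ker}(m,t₀)|³ )^{1/3} ≤ C·⟨t₀⟩^{−(4n/21 + 13/45)}. -/

import Mathlib

open MeasureTheory

/-- The lattice dispersion relation `ω_∞(ξ) = sin ξ₁ · (sin² ξ₁ + ⋯ + sin² ξ_d)`. -/
noncomputable def omegaInf {d : ℕ} [NeZero d] (ξ : Fin d → ℝ) : ℝ :=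
  Real.sin (ξ 0) * ∑ j, Real.sin (ξ j) ^ 2

/-- The kernel-weighted oscillatory sum
`𝔉^{Ker}(m,t₀) = ∫_{[−π,π]^d} |sin ξ₁|^n e^{i m·ξ} e^{i t₀ ω_∞(ξ)} dξ`. -/
noncomputable def FKer {d : ℕ} [NeZero d] (n : ℕ) (t₀ : ℝ) (m : Fin d → ℤ) : ℂ :=
  ∫ ξ in Set.univ.pi fun _ : Fin d => Set.Icc (-Real.pi) Real.pi,
    ((|Real.sin (ξ 0)| ^ n : ℝ) : ℂ) *
      Complex.exp (Complex.I * ((∑ j, (m j : ℝ) * ξ j : ℝ) : ℂ)) *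
      Complex.exp (Complex.I * ((t₀ * omegaInf ξ : ℝ) : ℂ))

/-- Second-derivative van der Corput estimate. -/
lemma norm_integral_exp_I_mul_le_of_second_deriv {φ p q : ℝ → ℝ}
    (hφ : ∀ x, HasDerivAt φ (p x) x) (hp : ∀ x, HasDerivAt p (q x) x) (hq : Continuous q)
    {a b l : ℝ} (hab : a ≤ b) (hl : 0 < l) (hlq : ∀ x ∈ Set.Icc a b, l ≤ q x) :
    ‖∫ x in a..b, Complex.exp (Complex.I * (φ x : ℂ))‖ ≤ 8 / Real.sqrt l := by
  have hφc : Continuous φ := continuous_iff_continuousAt.2 fun x => (hφ x).continuousAt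
  have hpc : Continuous p := continuous_iff_continuousAt.2 fun x => (hp x).continuousAt
  set μ := Real.sqrt l with hμ
  have hμ0 : 0 < μ := Real.sqrt_pos.2 hl
  have hμ2 : μ ^ 2 = l := Real.sq_sqrt hl.le
  have hpos : ∀ x, 0 < p x ^ 2 + l := fun x => by positivity
  set E : ℝ → ℂ := fun x => Complex.exp (Complex.I * (φ x : ℂ)) with hE
  have hEc : Continuous E := by fun_prop
  have hEn : ∀ x, ‖E x‖ = 1 := fun x => by
    simp only [hE]; rw [mul_comm]; exact Complex.norm_exp_ofReal_mul_I _
  set g : ℝ → ℝ := fun x => p x / (p x ^ 2 + l) with hg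
  set g' : ℝ → ℝ := fun x => q x * (l - p x ^ 2) / (p x ^ 2 + l) ^ 2 with hg'
  have hgd : ∀ x, HasDerivAt g (g' x) x := fun x => by
    have := (hp x).div (((hp x).pow 2).add_const l) (hpos x).ne'
    refine this.congr_deriv ?_
    simp only [hg']
    congr 1
    simp
    ring
  have hg'c : Continuous g' := by
    refine Continuous.div (by fun_prop) (by fun_prop) fun x => (pow_pos (hpos x) 2).ne'
  have hgc : Continuous g := continuous_iff_continuousAt.2 fun x => (hgd x).continuousAt
  have hEd : ∀ x, HasDerivAt E (E x * (Complex.I * (p x : ℂ))) x := fun x =>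
    (((hφ x).ofReal_comp).const_mul Complex.I).cexp
  set B : ℝ → ℂ := fun x => E x * (-Complex.I * (g x : ℂ)) with hB
  set B' : ℝ → ℂ := fun x => E x * (Complex.I * (p x : ℂ)) * (-Complex.I * (g x : ℂ)) +
    E x * (-Complex.I * (g' x : ℂ)) with hB'
  have hBd : ∀ x, HasDerivAt B (B' x) x := fun x =>
    (hEd x).mul (((hgd x).ofReal_comp).const_mul (-Complex.I))
  have hB'c : Continuous B' := by fun_prop
  have hBint : ∫ x in a..b, B' x = B b - B a :=
    intervalIntegral.integral_eq_sub_of_hasDerivAt (fun x _ => hBd x)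
      (hB'c.intervalIntegrable _ _)
  set T : ℝ → ℝ := fun x => 2 / μ * Real.arctan (p x / μ) with hT
  have hTd : ∀ x, HasDerivAt T (2 * q x / (p x ^ 2 + l)) x := fun x => by
    have := (((hp x).div_const μ).arctan).const_mul (2 / μ)
    refine this.congr_deriv ?_
    rw [← hμ2]
    field_simp
    ring
  have hT'c : Continuous fun x => 2 * q x / (p x ^ 2 + l) :=
    Continuous.div (by fun_prop) (by fun_prop) fun x => (hpos x).ne'
  have hTint : ∫ x in a..b, 2 * q x / (p x ^ 2 + l) = T b - T a :=
    intervalIntegral.integral_eq_sub_of_hasDerivAt (fun x _ => hTd x)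
      (hT'c.intervalIntegrable _ _)
  have hrem : ∀ x ∈ Set.Icc a b, ‖E x - B' x‖ ≤ 2 * q x / (p x ^ 2 + l) := fun x hx => by
    have hqx := hlq x hx
    have h1 : E x - B' x = E x * (((l / (p x ^ 2 + l) : ℝ) : ℂ) + Complex.I * (g' x : ℂ)) := by
      have : p x * g x = 1 - l / (p x ^ 2 + l) := by
        simp only [hg]
        have := (hpos x).ne'
        field_simp
        ring
      have h2 : ((l / (p x ^ 2 + l) : ℝ) : ℂ) = 1 - (p x : ℂ) * (g x : ℂ) := by
        rw [← Complex.ofReal_mul, this]; push_cast; ring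
      rw [h2]
      simp only [hB']
      linear_combination (E x * (p x : ℂ) * (g x : ℂ)) * Complex.I_sq
    rw [h1, norm_mul, hEn, one_mul]
    refine (norm_add_le _ _).trans ?_
    rw [norm_mul, Complex.norm_I, one_mul, Complex.norm_real, Complex.norm_real,
      Real.norm_eq_abs, Real.norm_eq_abs, abs_of_pos (div_pos hl (hpos x))]
    have h3 : |g' x| ≤ q x / (p x ^ 2 + l) := by
      simp only [hg']
      rw [abs_div, abs_mul, abs_of_pos (hl.trans_le hqx), abs_of_pos (pow_pos (hpos x) 2),
        div_le_div_iff₀ (pow_pos (hpos x) 2) (hpos x), sq (p x ^ 2 + l), mul_assoc]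
      refine mul_le_mul_of_nonneg_left ?_ (hl.trans_le hqx).le
      refine mul_le_mul_of_nonneg_right ?_ (hpos x).le
      rw [abs_le]
      constructor <;> nlinarith [sq_nonneg (p x)]
    have h4 : l / (p x ^ 2 + l) ≤ q x / (p x ^ 2 + l) := by
      have := (hpos x).le
      gcongr
    calc _ ≤ q x / (p x ^ 2 + l) + q x / (p x ^ 2 + l) := add_le_add h4 h3
      _ = _ := by ring
  have hBn : ∀ x, ‖B x‖ ≤ 1 / (2 * μ) := fun x => by
    simp only [hB]
    rw [norm_mul, hEn, one_mul, norm_mul, norm_neg, Complex.norm_I, one_mul, Complex.norm_real,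
      Real.norm_eq_abs]
    simp only [hg]
    rw [abs_div, abs_of_pos (hpos x), div_le_div_iff₀ (hpos x) (by positivity)]
    nlinarith [sq_nonneg (|p x| - μ), sq_abs (p x)]
  have hsplit : ∫ x in a..b, E x = (∫ x in a..b, (E x - B' x)) + (B b - B a) := by
    rw [intervalIntegral.integral_sub (hEc.intervalIntegrable _ _) (hB'c.intervalIntegrable _ _),
      hBint]
    ring
  have h5 : ‖∫ x in a..b, (E x - B' x)‖ ≤ T b - T a := by
    rw [← hTint]
    exact intervalIntegral.norm_integral_le_of_norm_le hab
      (Filter.Eventually.of_forall fun x hx => hrem x ⟨hx.1.le, hx.2⟩)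
      (hT'c.intervalIntegrable _ _)
  have h6 : T b - T a ≤ 2 / μ * Real.pi := by
    simp only [hT]
    rw [← mul_sub]
    refine mul_le_mul_of_nonneg_left ?_ (by positivity)
    linarith [Real.arctan_lt_pi_div_two (p b / μ), Real.neg_pi_div_two_lt_arctan (p a / μ)]
  rw [hsplit]
  calc _ ≤ (T b - T a) + (‖B b‖ + ‖B a‖) :=
        (norm_add_le _ _).trans (add_le_add h5 (norm_sub_le _ _))
    _ ≤ 2 / μ * Real.pi + (1 / (2 * μ) + 1 / (2 * μ)) :=
        add_le_add h6 (add_le_add (hBn b) (hBn a))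
    _ = (2 * Real.pi + 1) / μ := by field_simp; ring
    _ ≤ 8 / μ := by
        have := Real.pi_lt_d2
        gcongr
        linarith

lemma norm_intervalIntegral_exp_I_mul_le (φ : ℝ → ℝ) {a b : ℝ} (hab : a ≤ b) :
    ‖∫ x in a..b, Complex.exp (Complex.I * (φ x : ℂ))‖ ≤ b - a := by
  have := intervalIntegral.norm_integral_le_of_norm_le_const (a := a) (b := b) (C := 1)
    (f := fun x => Complex.exp (Complex.I * (φ x : ℂ))) fun x _ => by
      rw [mul_comm, Complex.norm_exp_ofReal_mul_I]
  simpa [abs_of_nonneg (sub_nonneg.2 hab)] using this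

lemma norm_integral_quarter_le (k c : ℝ) {τ δ : ℝ} (hδ : 0 < δ) (hτ : τ * δ ^ 3 = 1) :
    ‖∫ x in (-(Real.pi / 4))..(Real.pi / 4),
      Complex.exp (Complex.I * ((c + k * x + τ * Real.sin x ^ 2 : ℝ) : ℂ))‖ ≤ 10 * δ := by
  have hπ := Real.pi_pos
  have hτ0 : 0 < τ := by
    by_contra! h
    nlinarith [mul_nonneg (neg_nonneg.2 h) (pow_pos hδ 3).le]
  set φ : ℝ → ℝ := fun x => c + k * x + τ * Real.sin x ^ 2 with hφ
  have hφc : Continuous fun x => Complex.exp (Complex.I * (φ x : ℂ)) := by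
    simp only [hφ]; fun_prop
  rcases le_or_gt (Real.pi / 4) δ with h | h
  · refine (norm_intervalIntegral_exp_I_mul_le φ (by linarith)).trans ?_
    linarith
  have hd1 : ∀ x, HasDerivAt φ (k + τ * Real.sin (2 * x)) x := fun x => by
    have := (((hasDerivAt_id x).const_mul k).const_add c).add
      (((Real.hasDerivAt_sin x).pow 2).const_mul τ)
    refine this.congr_deriv ?_
    rw [Real.sin_two_mul]
    simp
  have hd2 : ∀ x, HasDerivAt (fun x => k + τ * Real.sin (2 * x)) (τ * (Real.cos (2 * x) * 2)) x :=
    fun x => by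
      have := ((((hasDerivAt_id x).const_mul 2).sin).const_mul τ).const_add k
      refine this.congr_deriv ?_
      simp
  have hmid : ‖∫ x in (-(Real.pi / 4 - δ))..(Real.pi / 4 - δ),
      Complex.exp (Complex.I * (φ x : ℂ))‖ ≤ 8 / Real.sqrt (τ * δ) := by
    refine norm_integral_exp_I_mul_le_of_second_deriv hd1 hd2 (by fun_prop) (by linarith)
      (by positivity) fun x hx => ?_
    refine mul_le_mul_of_nonneg_left ?_ hτ0.le
    have hx' : |x| ≤ Real.pi / 4 - δ := abs_le.2 hx
    have h1 : Real.cos (2 * x) = Real.sin (Real.pi / 2 - 2 * |x|) := by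
      rw [Real.sin_pi_div_two_sub, ← Real.cos_abs (2 * x), abs_mul, abs_two]
    have h2 := Real.mul_le_sin (x := Real.pi / 2 - 2 * |x|) (by linarith)
      (by linarith [abs_nonneg x])
    rw [h1]
    have h3 : 2 / Real.pi * (2 * δ) ≤ 2 / Real.pi * (Real.pi / 2 - 2 * |x|) := by
      gcongr; linarith
    have h4 : δ ≤ 2 / Real.pi * (2 * δ) * 2 := by
      rw [div_mul_eq_mul_div, div_mul_eq_mul_div, le_div_iff₀ hπ]
      nlinarith [Real.pi_lt_d2]
    linarith
  have hsq : 8 / Real.sqrt (τ * δ) = 8 * δ := by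
    have : τ * δ = (δ⁻¹) ^ 2 := by
      field_simp
      linarith
    rw [this, Real.sqrt_sq (by positivity)]
    field_simp
  have hi : ∀ a b : ℝ, IntervalIntegrable (fun x => Complex.exp (Complex.I * (φ x : ℂ)))
    volume a b := fun a b => hφc.intervalIntegrable a b
  rw [← intervalIntegral.integral_add_adjacent_intervals (hi _ (-(Real.pi / 4 - δ))) (hi _ _),
    ← intervalIntegral.integral_add_adjacent_intervals (hi (-(Real.pi / 4 - δ))
      (Real.pi / 4 - δ)) (hi _ _)]
  have e1 := norm_intervalIntegral_exp_I_mul_le φ (a := -(Real.pi / 4))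
    (b := -(Real.pi / 4 - δ)) (by linarith)
  have e2 := norm_intervalIntegral_exp_I_mul_le φ (a := Real.pi / 4 - δ)
    (b := Real.pi / 4) (by linarith)
  rw [hsq] at hmid
  have e3 := norm_add₃_le (a := ∫ x in (-(Real.pi / 4))..(-(Real.pi / 4 - δ)),
      Complex.exp (Complex.I * (φ x : ℂ)))
    (b := ∫ x in (-(Real.pi / 4 - δ))..(Real.pi / 4 - δ), Complex.exp (Complex.I * (φ x : ℂ)))
    (c := ∫ x in (Real.pi / 4 - δ)..(Real.pi / 4), Complex.exp (Complex.I * (φ x : ℂ)))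
  rw [← add_assoc]
  linarith

lemma norm_integral_quarter_le_rpow (k c : ℝ) {τ : ℝ} (hτ : τ ≠ 0) :
    ‖∫ x in (-(Real.pi / 4))..(Real.pi / 4),
      Complex.exp (Complex.I * ((c + k * x + τ * Real.sin x ^ 2 : ℝ) : ℂ))‖ ≤
      10 * |τ| ^ (-(1 : ℝ) / 3) := by
  have key : ∀ (k c : ℝ) {τ : ℝ}, 0 < τ →
      ‖∫ x in (-(Real.pi / 4))..(Real.pi / 4),
      Complex.exp (Complex.I * ((c + k * x + τ * Real.sin x ^ 2 : ℝ) : ℂ))‖ ≤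
      10 * τ ^ (-(1 : ℝ) / 3) := fun k c τ hτ =>
    norm_integral_quarter_le k c (by positivity) (by
      rw [← Real.rpow_natCast, ← Real.rpow_mul hτ.le]
      norm_num
      rw [Real.rpow_neg_one, mul_inv_cancel₀ hτ.ne'])
  rcases lt_or_gt_of_ne hτ with h | h
  · rw [abs_of_neg h]
    refine le_trans (le_of_eq ?_) (key (-k) (-c) (neg_pos.2 h))
    rw [← RCLike.norm_conj, ← intervalIntegral.intervalIntegral_conj]
    congr 2
    ext x
    rw [← Complex.exp_conj, map_mul, Complex.conj_I, Complex.conj_ofReal]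
    congr 1
    push_cast
    ring
  · rw [abs_of_pos h]
    exact key k c h

/-- Uniform decay of the one-dimensional kernel. -/
lemma norm_integral_exp_sin_sq_le (m : ℤ) {τ : ℝ} (hτ : τ ≠ 0) :
    ‖∫ x in (-Real.pi)..Real.pi,
      Complex.exp (Complex.I * ((m * x + τ * Real.sin x ^ 2 : ℝ) : ℂ))‖ ≤
      40 * |τ| ^ (-(1 : ℝ) / 3) := by
  set f : ℝ → ℂ := fun x => Complex.exp (Complex.I * ((m * x + τ * Real.sin x ^ 2 : ℝ) : ℂ))
    with hf
  have hfc : Continuous f := by simp only [hf]; fun_prop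
  have hper : Function.Periodic f (2 * Real.pi) := fun x => by
    simp only [hf]
    rw [Real.sin_add_two_pi, Complex.exp_eq_exp_iff_exists_int]
    exact ⟨m, by push_cast; ring⟩
  have h1 : ∫ x in (-Real.pi)..Real.pi, f x =
      ∫ x in (-(Real.pi / 4))..(-(Real.pi / 4) + 2 * Real.pi), f x := by
    have := hper.intervalIntegral_add_eq (-Real.pi) (-(Real.pi / 4))
    rw [← this]
    congr 1
    ring
  have hi : ∀ a b : ℝ, IntervalIntegrable f volume a b := fun a b => hfc.intervalIntegrable a b
  have even_shift : ∀ c : ℝ, (∀ x, Real.sin (x + c) ^ 2 = Real.sin x ^ 2) →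
      ‖∫ x in (-(Real.pi / 4) + c)..(Real.pi / 4 + c), f x‖ ≤ 10 * |τ| ^ (-(1 : ℝ) / 3) := by
    intro c hc
    refine le_trans (le_of_eq ?_) (norm_integral_quarter_le_rpow m (m * c) hτ)
    rw [← intervalIntegral.integral_comp_add_right]
    congr 2
    ext x
    simp only [hf]
    rw [hc]
    congr 3
    ring
  have odd_shift : ∀ c : ℝ, (∀ x, Real.sin (x + c) ^ 2 = 1 - Real.sin x ^ 2) →
      ‖∫ x in (-(Real.pi / 4) + c)..(Real.pi / 4 + c), f x‖ ≤ 10 * |τ| ^ (-(1 : ℝ) / 3) := by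
    intro c hc
    have := norm_integral_quarter_le_rpow m (m * c + τ) (neg_ne_zero.2 hτ)
    rw [abs_neg] at this
    refine le_trans (le_of_eq ?_) this
    rw [← intervalIntegral.integral_comp_add_right]
    congr 2
    ext x
    simp only [hf]
    rw [hc]
    congr 3
    ring
  have e0 := even_shift 0 fun x => by rw [add_zero]
  have e1 := odd_shift (Real.pi / 2) fun x => by
    rw [Real.sin_add_pi_div_two, Real.cos_sq']
  have e2 := even_shift Real.pi fun x => by rw [Real.sin_add_pi, neg_sq]
  have e3 := odd_shift (Real.pi + Real.pi / 2) fun x => by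
    rw [← add_assoc, Real.sin_add_pi_div_two, Real.cos_add_pi, neg_sq, Real.cos_sq']
  rw [add_zero, add_zero] at e0
  rw [show -(Real.pi / 4) + Real.pi / 2 = Real.pi / 4 by ring] at e1
  rw [show -(Real.pi / 4) + Real.pi = Real.pi / 4 + Real.pi / 2 by ring] at e2
  rw [show -(Real.pi / 4) + (Real.pi + Real.pi / 2) = Real.pi / 4 + Real.pi by ring,
    show Real.pi / 4 + (Real.pi + Real.pi / 2) = -(Real.pi / 4) + 2 * Real.pi by ring] at e3
  rw [h1, ← intervalIntegral.integral_add_adjacent_intervals (hi _ (Real.pi / 4)) (hi _ _),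
    ← intervalIntegral.integral_add_adjacent_intervals (hi (Real.pi / 4)
      (Real.pi / 4 + Real.pi / 2)) (hi _ _),
    ← intervalIntegral.integral_add_adjacent_intervals (hi (Real.pi / 4 + Real.pi / 2)
      (Real.pi / 4 + Real.pi)) (hi _ _)]
  refine (norm_add_le _ _).trans ?_
  have n1 := norm_add_le (∫ x in (Real.pi / 4)..(Real.pi / 4 + Real.pi / 2), f x)
    ((∫ x in (Real.pi / 4 + Real.pi / 2)..(Real.pi / 4 + Real.pi), f x) +
      ∫ x in (Real.pi / 4 + Real.pi)..(-(Real.pi / 4) + 2 * Real.pi), f x)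
  have n2 := norm_add_le (∫ x in (Real.pi / 4 + Real.pi / 2)..(Real.pi / 4 + Real.pi), f x)
    (∫ x in (Real.pi / 4 + Real.pi)..(-(Real.pi / 4) + 2 * Real.pi), f x)
  linarith

lemma norm_integral_exp_sin_sq_le_of_le (m : ℤ) {τ β : ℝ} (hτ : τ ≠ 0) (hβ : 0 ≤ β)
    (hβ' : β ≤ 1 / 3) :
    ‖∫ x in (-Real.pi)..Real.pi,
      Complex.exp (Complex.I * ((m * x + τ * Real.sin x ^ 2 : ℝ) : ℂ))‖ ≤ 40 * |τ| ^ (-β) := by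
  have hτ' := abs_pos.2 hτ
  rcases le_or_gt 1 |τ| with h | h
  · refine (norm_integral_exp_sin_sq_le m hτ).trans ?_
    gcongr 40 * ?_
    exact Real.rpow_le_rpow_of_exponent_le h (by linarith)
  · have h1 := norm_intervalIntegral_exp_I_mul_le (fun x => m * x + τ * Real.sin x ^ 2)
      (a := -Real.pi) (b := Real.pi) (by linarith [Real.pi_pos])
    have h2 := Real.one_le_rpow_of_pos_of_le_one_of_nonpos hτ' h.le (neg_nonpos.2 hβ)
    refine h1.trans ?_
    linarith [Real.pi_lt_d2]

lemma intervalIntegrable_abs_sin_rpow {r : ℝ} (hr : -1 < r) (hr0 : r ≤ 0) (a b : ℝ) :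
    IntervalIntegrable (fun x => |Real.sin x| ^ r) volume a b := by
  have hπ := Real.pi_pos
  have hm : Measurable fun x => |Real.sin x| ^ r := by fun_prop
  have hper : Function.Periodic (fun x => |Real.sin x| ^ r) Real.pi := fun x => by
    simp only [Real.sin_add_pi, abs_neg]
  have h1 : IntervalIntegrable (fun x => |Real.sin x| ^ r) volume 0 (Real.pi / 2) := by
    refine ((intervalIntegral.intervalIntegrable_rpow' hr).const_mul ((2 / Real.pi) ^ r)).mono_fun
      hm.aestronglyMeasurable ?_
    refine (ae_restrict_iff' measurableSet_uIoc).2 (Filter.Eventually.of_forall fun x hx => ?_)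
    rw [Set.uIoc_of_le (by positivity)] at hx
    have hx0 : 0 < 2 / Real.pi * x := mul_pos (by positivity) hx.1
    have h2 := Real.mul_le_sin hx.1.le hx.2
    beta_reduce
    rw [← Real.mul_rpow (by positivity) hx.1.le, Real.norm_of_nonneg (by positivity),
      Real.norm_of_nonneg (by positivity), abs_of_pos (hx0.trans_le h2)]
    exact Real.rpow_le_rpow_of_nonpos hx0 h2 hr0
  have h2 : IntervalIntegrable (fun x => |Real.sin x| ^ r) volume (-(Real.pi / 2)) 0 := by
    rw [IntervalIntegrable.iff_comp_neg]
    simpa only [Real.sin_neg, abs_neg, neg_neg, neg_zero] using h1.symm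
  refine hper.intervalIntegrable hπ.ne' (t := -(Real.pi / 2)) ?_ a b
  convert h2.trans h1 using 1
  ring

lemma ae_sin_ne_zero : ∀ᵐ x : ℝ, Real.sin x ≠ 0 := by
  refine compl_mem_ae_iff.2 (Set.Countable.measure_zero ?_ _)
  refine (Set.countable_range fun k : ℤ => (k : ℝ) * Real.pi).mono fun x hx => ?_
  exact Real.sin_eq_zero_iff.1 hx

/-- Lebesgue measure on `[-π, π]`. -/
noncomputable def periodMeasure : Measure ℝ := volume.restrict (Set.Icc (-Real.pi) Real.pi)

instance : IsFiniteMeasure periodMeasure := by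
  unfold periodMeasure; infer_instance

lemma integral_periodMeasure (f : ℝ → ℂ) :
    ∫ x, f x ∂periodMeasure = ∫ x in (-Real.pi)..Real.pi, f x := by
  rw [periodMeasure, integral_Icc_eq_integral_Ioc,
    intervalIntegral.integral_of_le (by linarith [Real.pi_pos])]

lemma periodMeasure_real_univ : periodMeasure.real Set.univ = 2 * Real.pi := by
  simp [periodMeasure, Measure.real, two_mul, Real.pi_pos.le]

/-- The amplitude and time oscillation in the definition of `FKer`. -/
noncomputable def kernelSymbol {d : ℕ} [NeZero d] (n : ℕ) (t : ℝ) (ξ : Fin d → ℝ) : ℂ :=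
  ((|Real.sin (ξ 0)| ^ n : ℝ) : ℂ) * Complex.exp (Complex.I * ((t * omegaInf ξ : ℝ) : ℂ))

lemma continuous_kernelSymbol {d : ℕ} [NeZero d] (n : ℕ) (t : ℝ) :
    Continuous (kernelSymbol (d := d) n t) := by
  unfold kernelSymbol omegaInf
  fun_prop

lemma norm_kernelSymbol_le_one {d : ℕ} [NeZero d] (n : ℕ) (t : ℝ) (ξ : Fin d → ℝ) :
    ‖kernelSymbol n t ξ‖ ≤ 1 := by
  rw [kernelSymbol, norm_mul, mul_comm Complex.I, Complex.norm_exp_ofReal_mul_I, mul_one,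
    Complex.norm_real, Real.norm_of_nonneg (by positivity)]
  exact pow_le_one₀ (abs_nonneg _) (Real.abs_sin_le_one _)

/-- The character `ξ ↦ e^{i m·ξ}`. -/
noncomputable def expChar {d : ℕ} (m : Fin d → ℤ) (ξ : Fin d → ℝ) : ℂ :=
  Complex.exp (Complex.I * ((∑ j, (m j : ℝ) * ξ j : ℝ) : ℂ))

lemma continuous_expChar {d : ℕ} (m : Fin d → ℤ) : Continuous (expChar m) := by
  unfold expChar
  fun_prop

lemma norm_expChar {d : ℕ} (m : Fin d → ℤ) (ξ : Fin d → ℝ) : ‖expChar m ξ‖ = 1 := by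
  rw [expChar, mul_comm, Complex.norm_exp_ofReal_mul_I]

lemma FKer_eq {d : ℕ} [NeZero d] (n : ℕ) (t : ℝ) (m : Fin d → ℤ) :
    FKer n t m =
      ∫ ξ, expChar m ξ * kernelSymbol n t ξ ∂(Measure.pi fun _ : Fin d => periodMeasure) := by
  unfold FKer periodMeasure
  rw [volume_pi, Measure.restrict_pi_pi]
  refine integral_congr_ae (Filter.Eventually.of_forall fun ξ => ?_)
  simp only [expChar, kernelSymbol]
  ring

lemma integral_exp_int (k : ℤ) :
    ∫ x, Complex.exp (Complex.I * ((k * x : ℝ) : ℂ)) ∂periodMeasure =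
      if k = 0 then 2 * (Real.pi : ℂ) else 0 := by
  rw [integral_periodMeasure]
  split_ifs with h
  · simp [h, two_mul]
  · have hk : Complex.I * (k : ℂ) ≠ 0 := mul_ne_zero Complex.I_ne_zero (by exact_mod_cast h)
    have h1 := integral_exp_mul_complex (a := -Real.pi) (b := Real.pi) hk
    have h2 : Complex.exp (Complex.I * (k : ℂ) * (Real.pi : ℝ)) =
        Complex.exp (Complex.I * (k : ℂ) * ((-Real.pi : ℝ) : ℂ)) := by
      rw [Complex.exp_eq_exp_iff_exists_int]
      exact ⟨k, by push_cast; ring⟩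
    rw [h2, sub_self, zero_div] at h1
    rw [← h1]
    congr 1
    ext x
    push_cast
    ring_nf

lemma integral_expChar {d : ℕ} (m : Fin d → ℤ) :
    ∫ ξ, expChar m ξ ∂(Measure.pi fun _ : Fin d => periodMeasure) =
      if m = 0 then (2 * (Real.pi : ℂ)) ^ d else 0 := by
  have h : ∀ ξ : Fin d → ℝ, expChar m ξ =
      ∏ j, Complex.exp (Complex.I * ((m j * ξ j : ℝ) : ℂ)) := fun ξ => by
    rw [expChar, ← Complex.exp_sum]
    push_cast
    rw [Finset.mul_sum]
  simp_rw [h]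
  rw [integral_fintype_prod_eq_prod
    (f := fun j x => Complex.exp (Complex.I * (((m j : ℤ) * x : ℝ) : ℂ)))]
  simp_rw [integral_exp_int]
  split_ifs with hm
  · simp [hm]
  · obtain ⟨j, hj⟩ := Function.ne_iff.1 hm
    exact Finset.prod_eq_zero (Finset.mem_univ j) (if_neg hj)

lemma expChar_mul_conj {d : ℕ} (m k : Fin d → ℤ) (ξ : Fin d → ℝ) :
    expChar m ξ * (starRingEnd ℂ) (expChar k ξ) = expChar (m - k) ξ := by
  unfold expChar
  rw [← Complex.exp_conj, ← Complex.exp_add, map_mul, Complex.conj_I, Complex.conj_ofReal]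
  congr 1
  simp only [Pi.sub_apply, Int.cast_sub, sub_mul, Finset.sum_sub_distrib]
  push_cast
  ring

lemma inner_toLp_toLp {X : Type*} [MeasurableSpace X] {μ : Measure X} {f g : X → ℂ}
    (hf : MemLp f 2 μ) (hg : MemLp g 2 μ) :
    inner ℂ (hf.toLp f) (hg.toLp g) = ∫ x, g x * (starRingEnd ℂ) (f x) ∂μ := by
  rw [L2.inner_def]
  refine integral_congr_ae ?_
  filter_upwards [hf.coeFn_toLp, hg.coeFn_toLp] with x h1 h2
  rw [h1, h2, RCLike.inner_apply]

/-- Bessel's inequality for multiple Fourier coefficients on `[-π, π]^d`. -/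
lemma sum_sq_norm_integral_expChar_mul_le {d : ℕ} {f : (Fin d → ℝ) → ℂ} (hfc : Continuous f)
    (hf1 : ∀ ξ, ‖f ξ‖ ≤ 1) (s : Finset (Fin d → ℤ)) :
    ∑ m ∈ s, ‖∫ ξ, expChar m ξ * f ξ ∂(Measure.pi fun _ : Fin d => periodMeasure)‖ ^ 2 ≤
      (2 * Real.pi) ^ (2 * d) := by
  have hπ := Real.pi_pos
  set μ : Measure (Fin d → ℝ) := Measure.pi fun _ : Fin d => periodMeasure with hμ
  have hμu : μ.real Set.univ = (2 * Real.pi) ^ d := by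
    rw [Measure.real, hμ, Measure.pi_univ, ENNReal.toReal_prod, Finset.prod_const, Finset.card_univ,
      Fintype.card_fin]
    exact congrArg (· ^ d) periodMeasure_real_univ
  set c : ℝ := (Real.sqrt ((2 * Real.pi) ^ d))⁻¹ with hc
  have hc2 : c ^ 2 = ((2 * Real.pi) ^ d)⁻¹ := by
    rw [hc, inv_pow, Real.sq_sqrt (by positivity)]
  have hm : ∀ m : Fin d → ℤ, MemLp (fun ξ => (c : ℂ) * expChar (-m) ξ) 2 μ := fun m =>
    MemLp.of_bound (((continuous_expChar _).const_mul _).aestronglyMeasurable) |c|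
      (Filter.Eventually.of_forall fun ξ => by
        rw [norm_mul, norm_expChar, mul_one, Complex.norm_real, Real.norm_eq_abs])
  have hfm : MemLp f 2 μ := MemLp.of_bound hfc.aestronglyMeasurable 1
    (Filter.Eventually.of_forall hf1)
  have hon : Orthonormal ℂ fun m : Fin d → ℤ => (hm m).toLp _ := by
    rw [orthonormal_iff_ite]
    intro m k
    rw [inner_toLp_toLp]
    have : ∀ ξ : Fin d → ℝ, (c : ℂ) * expChar (-k) ξ *
        (starRingEnd ℂ) ((c : ℂ) * expChar (-m) ξ) = (c : ℂ) ^ 2 * expChar (m - k) ξ := fun ξ => by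
      rw [show m - k = -k - -m by ring, ← expChar_mul_conj, map_mul, Complex.conj_ofReal]
      ring
    simp_rw [this]
    rw [integral_const_mul, integral_expChar]
    by_cases h : m = k
    · rw [if_pos (sub_eq_zero.2 h), if_pos h, ← Complex.ofReal_pow, hc2]
      push_cast
      exact inv_mul_cancel₀ (pow_ne_zero _ (by simp [hπ.ne']))
    · rw [if_neg (sub_ne_zero.2 h), if_neg h, mul_zero]
  have hb := hon.sum_inner_products_le (hfm.toLp f) (s := s)
  have hin : ∀ m : Fin d → ℤ, ‖inner ℂ ((hm m).toLp _) (hfm.toLp f)‖ ^ 2 =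
      c ^ 2 * ‖∫ ξ, expChar m ξ * f ξ ∂μ‖ ^ 2 := fun m => by
    rw [inner_toLp_toLp]
    have : ∀ ξ : Fin d → ℝ, f ξ * (starRingEnd ℂ) ((c : ℂ) * expChar (-m) ξ) =
        (c : ℂ) * (expChar m ξ * f ξ) := fun ξ => by
      have h0 : expChar (0 : Fin d → ℤ) ξ = 1 := by simp [expChar]
      have := expChar_mul_conj 0 (-m) ξ
      rw [h0, one_mul, sub_neg_eq_add, zero_add] at this
      rw [map_mul, this, Complex.conj_ofReal]
      ring
    simp_rw [this]
    rw [integral_const_mul, norm_mul, mul_pow, Complex.norm_real, Real.norm_eq_abs, sq_abs]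
  have hfn : ‖hfm.toLp f‖ ^ 2 ≤ (2 * Real.pi) ^ d := by
    rw [@norm_sq_eq_re_inner ℂ, inner_toLp_toLp]
    refine (RCLike.re_le_norm _).trans ?_
    have := norm_integral_le_of_norm_le_const (μ := μ) (C := 1)
      (f := fun x => f x * (starRingEnd ℂ) (f x)) (Filter.Eventually.of_forall fun x => by
        rw [norm_mul, RCLike.norm_conj]
        exact mul_le_one₀ (hf1 x) (norm_nonneg _) (hf1 x))
    rwa [one_mul, hμu] at this
  simp_rw [hin] at hb
  rw [← Finset.mul_sum, hc2, inv_mul_le_iff₀ (by positivity)] at hb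
  refine hb.trans ?_
  rw [two_mul d, pow_add]
  gcongr

lemma norm_FKer_le {d : ℕ} [NeZero d] (n : ℕ) (t : ℝ) (m : Fin d → ℤ) :
    ‖FKer n t m‖ ≤ (2 * Real.pi) ^ d := by
  have h := sum_sq_norm_integral_expChar_mul_le (continuous_kernelSymbol n t)
    (norm_kernelSymbol_le_one n t) {m}
  rw [Finset.sum_singleton, ← FKer_eq, mul_comm 2 d, pow_mul] at h
  have := Real.pi_pos
  exact (pow_le_pow_iff_left₀ (norm_nonneg _) (by positivity) two_ne_zero).1 h

lemma norm_FKer_le_rpow {N : ℕ} [NeZero (N + 1)] (hN : 0 < N) (n : ℕ) (m : Fin (N + 1) → ℤ)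
    {t α : ℝ} (ht : t ≠ 0) (hα0 : 0 ≤ α) (hαN : α ≤ N / 3) (hαn : α ≤ n + 13 / 15) :
    ‖FKer n t m‖ ≤
      40 ^ N * (∫ x, |Real.sin x| ^ (-(13 : ℝ) / 15) ∂periodMeasure) * |t| ^ (-α) := by
  have hN' : (0 : ℝ) < N := by exact_mod_cast hN
  have hsplit : ∀ (x : ℝ) (y : Fin N → ℝ),
      expChar m (Fin.cons x y) * kernelSymbol n t (Fin.cons x y : Fin (N + 1) → ℝ) =
        ((|Real.sin x| ^ n : ℝ) : ℂ) *
          Complex.exp (Complex.I * ((m 0 * x + t * Real.sin x ^ 3 : ℝ) : ℂ)) *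
          ∏ j : Fin N, Complex.exp (Complex.I *
            ((m j.succ * y j + t * Real.sin x * Real.sin (y j) ^ 2 : ℝ) : ℂ)) := by
    intro x y
    have h0 : (Fin.cons x y : Fin (N + 1) → ℝ) 0 = x := rfl
    unfold expChar kernelSymbol omegaInf
    rw [← Complex.exp_sum, mul_left_comm, ← Complex.exp_add, mul_assoc, ← Complex.exp_add,
      ← Finset.mul_sum, ← Complex.ofReal_sum]
    erw [h0]
    congr 2
    rw [← mul_add, ← mul_add, ← Complex.ofReal_add, ← Complex.ofReal_add]
    congr 2
    rw [Fin.sum_univ_succ, Fin.sum_univ_succ, Finset.sum_add_distrib, ← Finset.mul_sum]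
    simp only [Fin.cons_zero, Fin.cons_succ]
    ring
  have hcont : Continuous fun z : ℝ × (Fin N → ℝ) =>
      expChar m (Fin.cons z.1 z.2) * kernelSymbol n t (Fin.cons z.1 z.2 : Fin (N + 1) → ℝ) := by
    simp_rw [hsplit]
    fun_prop
  have hint : Integrable (fun z : ℝ × (Fin N → ℝ) =>
      expChar m (Fin.cons z.1 z.2) * kernelSymbol n t (Fin.cons z.1 z.2 : Fin (N + 1) → ℝ))
      (periodMeasure.prod (Measure.pi fun _ : Fin N => periodMeasure)) :=
    Integrable.of_bound hcont.aestronglyMeasurable 1 (Filter.Eventually.of_forall fun z => by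
      rw [norm_mul, norm_expChar, one_mul]
      exact norm_kernelSymbol_le_one _ _ _)
  have hF : FKer n t m = ∫ x, ((|Real.sin x| ^ n : ℝ) : ℂ) *
      Complex.exp (Complex.I * ((m 0 * x + t * Real.sin x ^ 3 : ℝ) : ℂ)) *
      (∏ j : Fin N, ∫ y in (-Real.pi)..Real.pi, Complex.exp (Complex.I *
        ((m j.succ * y + t * Real.sin x * Real.sin y ^ 2 : ℝ) : ℂ))) ∂periodMeasure := by
    rw [FKer_eq, ← (measurePreserving_piFinSuccAbove (fun _ : Fin (N + 1) => periodMeasure)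
      0).symm.integral_comp']
    have hcons : ∀ z : ℝ × (Fin N → ℝ),
        (MeasurableEquiv.piFinSuccAbove (fun _ : Fin (N + 1) => ℝ) 0).symm z =
          Fin.cons z.1 z.2 := fun z => by
      simp [MeasurableEquiv.piFinSuccAbove, Fin.insertNthEquiv]
    simp_rw [hcons]
    rw [integral_prod _ hint]
    refine integral_congr_ae (Filter.Eventually.of_forall fun x => ?_)
    simp only [hsplit]
    rw [integral_const_mul, integral_fintype_prod_eq_prod (f := fun (j : Fin N) y =>
      Complex.exp (Complex.I *
        ((m j.succ * y + t * Real.sin x * Real.sin y ^ 2 : ℝ) : ℂ)))]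
    simp_rw [integral_periodMeasure]
  have hsin : Integrable (fun x => |Real.sin x| ^ (-(13 : ℝ) / 15)) periodMeasure := by
    have := intervalIntegrable_abs_sin_rpow (r := -(13 : ℝ) / 15) (by norm_num) (by norm_num)
      (-Real.pi) Real.pi
    rwa [intervalIntegrable_iff_integrableOn_Icc_of_le (by linarith [Real.pi_pos])] at this
  have hae : ∀ᵐ x ∂periodMeasure, Real.sin x ≠ 0 := ae_restrict_of_ae ae_sin_ne_zero
  rw [hF, mul_right_comm, ← integral_const_mul]
  refine norm_integral_le_of_norm_le (hsin.const_mul _) ?_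
  filter_upwards [hae] with x hx
  have hx0 := abs_pos.2 hx
  rw [norm_mul, norm_mul, mul_comm Complex.I, Complex.norm_exp_ofReal_mul_I, mul_one,
    Complex.norm_real, Real.norm_of_nonneg (by positivity), norm_prod]
  have hK : ∏ j : Fin N, ‖∫ y in (-Real.pi)..Real.pi, Complex.exp (Complex.I *
      ((m j.succ * y + t * Real.sin x * Real.sin y ^ 2 : ℝ) : ℂ))‖ ≤
      40 ^ N * (|t| ^ (-α) * |Real.sin x| ^ (-α)) := by
    calc _ ≤ ∏ j : Fin N, 40 * |t * Real.sin x| ^ (-(α / N)) :=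
          Finset.prod_le_prod (fun _ _ => norm_nonneg _) fun j _ =>
            norm_integral_exp_sin_sq_le_of_le _ (mul_ne_zero ht hx) (by positivity)
              (by rw [div_le_iff₀ hN']; linarith)
      _ = _ := by
          rw [Finset.prod_const, Finset.card_univ, Fintype.card_fin, mul_pow,
            ← Real.rpow_mul_natCast (abs_nonneg _), abs_mul,
            Real.mul_rpow (abs_nonneg _) (abs_nonneg _)]
          congr 3 <;> field_simp
  calc _ ≤ |Real.sin x| ^ n * (40 ^ N * (|t| ^ (-α) * |Real.sin x| ^ (-α))) := by gcongr
    _ = 40 ^ N * |t| ^ (-α) * |Real.sin x| ^ ((n : ℝ) + -α) := by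
        rw [Real.rpow_add hx0, Real.rpow_natCast]
        ring
    _ ≤ _ := by
        gcongr 40 ^ N * |t| ^ (-α) * ?_
        exact Real.rpow_le_rpow_of_exponent_ge hx0 (Real.abs_sin_le_one x) (by linarith)

lemma exists_norm_FKer_le {d n : ℕ} [NeZero d] (hn : 2 * n + 5 < d) :
    ∃ D : ℝ, 0 < D ∧ ∀ (t : ℝ) (m : Fin d → ℤ),
      ‖FKer n t m‖ ≤ D * Real.sqrt (1 + t ^ 2) ^ (-(4 * (n : ℝ) / 7 + 13 / 15)) := by
  obtain ⟨N, rfl⟩ : ∃ N, d = N + 1 := ⟨d - 1, by omega⟩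
  have hN : (2 * n + 5 : ℝ) ≤ N := by exact_mod_cast (by omega : 2 * n + 5 ≤ N)
  have hn0 : (0 : ℝ) ≤ n := n.cast_nonneg
  have hπ := Real.pi_pos
  set α : ℝ := 4 * (n : ℝ) / 7 + 13 / 15 with hα
  have hα0 : 0 ≤ α := by positivity
  set J := ∫ x, |Real.sin x| ^ (-(13 : ℝ) / 15) ∂periodMeasure
  have hJ : 0 ≤ J := integral_nonneg fun x => by positivity
  refine ⟨(40 ^ N * J + (2 * Real.pi) ^ (N + 1)) * 2 ^ α, by positivity, fun t m => ?_⟩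
  set w := Real.sqrt (1 + t ^ 2) with hw
  have hw0 : 0 < w := Real.sqrt_pos.2 (by positivity)
  have hw2 : w ^ 2 = 1 + t ^ 2 := Real.sq_sqrt (by positivity)
  have key : (2 : ℝ) ^ α * w ^ (-α) = (w / 2) ^ (-α) := by
    rw [Real.div_rpow hw0.le two_pos.le, Real.rpow_neg two_pos.le, div_inv_eq_mul, mul_comm]
  rw [mul_assoc, key, add_mul]
  have p1 : 0 ≤ 40 ^ N * J * (w / 2) ^ (-α) := by positivity
  have p2 : 0 ≤ (2 * Real.pi) ^ (N + 1) * (w / 2) ^ (-α) := by positivity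
  rcases le_or_gt 1 |t| with h | h
  · have h1 : ‖FKer n t m‖ ≤ 40 ^ N * J * |t| ^ (-α) := norm_FKer_le_rpow (by exact_mod_cast (by linarith : (0 : ℝ) < N)) n m
      (abs_pos.1 (one_pos.trans_le h)) hα0 (by rw [hα]; linarith) (by rw [hα]; linarith)
    have h2 : |t| ^ (-α) ≤ (w / 2) ^ (-α) := by
      refine Real.rpow_le_rpow_of_nonpos (by positivity) ?_ (by linarith)
      refine abs_le_of_sq_le_sq' ?_ (abs_nonneg t) |>.2
      nlinarith [sq_abs t]
    have h3 : 40 ^ N * J * |t| ^ (-α) ≤ 40 ^ N * J * (w / 2) ^ (-α) := by gcongr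
    linarith
  · have h1 := norm_FKer_le n t m
    have h2 : 1 ≤ (w / 2) ^ (-α) := by
      refine Real.one_le_rpow_of_pos_of_le_one_of_nonpos (by positivity) ?_ (by linarith)
      have : w ≤ 2 := abs_le_of_sq_le_sq' (by nlinarith [sq_abs t, abs_nonneg t]) two_pos.le |>.2
      linarith
    have h3 := le_mul_of_one_le_right (by positivity : 0 ≤ (2 * Real.pi) ^ (N + 1)) h2
    linarith

/-- If `2n + 5 < d`, there is a constant `C` depending only on `d` and
`n`, and independent of `t₀`, such that the `ℓ³` norm of `𝔉^{Ker}(·,t₀)` decays like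
`⟨t₀⟩^{−(4n/21 + 13/45)}`, where `⟨t₀⟩ = (1 + t₀²)^{1/2}`. -/
theorem l3_decay_FKer (d n : ℕ) [NeZero d] (hd : 2 ≤ d) (hn : 2 * n + 5 < d) :
    ∃ C : ℝ, 0 < C ∧
      ∀ t₀ : ℝ,
        Summable (fun m : Fin d → ℤ => ‖FKer (d := d) n t₀ m‖ ^ 3) ∧
          (∑' m : Fin d → ℤ, ‖FKer (d := d) n t₀ m‖ ^ 3) ^ ((1 : ℝ) / 3) ≤
            C * Real.sqrt (1 + t₀ ^ 2) ^ (-(4 * (n : ℝ) / 21 + 13 / 45)) := by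
  obtain ⟨D, hD, hsup⟩ := exists_norm_FKer_le hn
  have hπ := Real.pi_pos
  set A : ℝ := (2 * Real.pi) ^ (2 * d) with hA
  have hA0 : 0 < A := by positivity
  refine ⟨(D * A) ^ ((1 : ℝ) / 3), by positivity, fun t => ?_⟩
  set w := Real.sqrt (1 + t ^ 2) with hw
  have hw0 : 0 < w := Real.sqrt_pos.2 (by positivity)
  set α : ℝ := 4 * (n : ℝ) / 7 + 13 / 15 with hα
  have hsum : ∀ s : Finset (Fin d → ℤ), ∑ m ∈ s, ‖FKer n t m‖ ^ 3 ≤ D * A * w ^ (-α) := by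
    intro s
    have hb := sum_sq_norm_integral_expChar_mul_le (continuous_kernelSymbol n t)
      (norm_kernelSymbol_le_one n t) s
    simp_rw [← FKer_eq] at hb
    calc _ ≤ ∑ m ∈ s, D * w ^ (-α) * ‖FKer n t m‖ ^ 2 :=
          Finset.sum_le_sum fun m _ => by
            rw [pow_succ' _ 2]
            exact mul_le_mul_of_nonneg_right (hsup t m) (by positivity)
      _ = D * w ^ (-α) * ∑ m ∈ s, ‖FKer n t m‖ ^ 2 := by rw [Finset.mul_sum]
      _ ≤ D * w ^ (-α) * A := by gcongr
      _ = _ := by ring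
  refine ⟨summable_of_sum_le (fun m => by positivity) hsum, ?_⟩
  have h1 : ∑' m : Fin d → ℤ, ‖FKer n t m‖ ^ 3 ≤ D * A * w ^ (-α) :=
    Real.tsum_le_of_sum_le (fun m => by positivity) hsum
  calc _ ≤ (D * A * w ^ (-α)) ^ ((1 : ℝ) / 3) :=
        Real.rpow_le_rpow (tsum_nonneg fun m => by positivity) h1 (by norm_num)
    _ = _ := by
        rw [Real.mul_rpow (by positivity) (by positivity), ← Real.rpow_mul hw0.le]
        congr 2
        rw [hα]
        ring
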